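/- arXiv:1511.06406 — 4 statements merged into one kernel-verified Lean document; each statement's English description precedes it below -/
import Mathlib

section
/- Under the denoising variational autoencoder setup, the denoising variational lower bound is a lower bound on the marginal log-likelihood: L_dvae ≤ log p(x). -/
open MeasureTheory

/-- The pointwise inequality behind Gibbs' inequality, for an unnormalised numerator. -/
lemma mul_log_div_le {q p c : ℝ} (hq : 0 < q) (hp : 0 < p) (hc : 0 < c) :
    q * Real.log (p / q) ≤ p / c - q + q * Real.log c := by
  have h := Real.log_le_sub_one_of_pos (show 0 < p / q / c by positivity)
  rw [Real.log_div (by positivity) hc.ne'] at h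
  have h' := mul_le_mul_of_nonneg_left h hq.le
  have e : q * (p / q / c - 1) = p / c - q := by field_simp
  rw [e] at h'
  linarith

/-- The denoising variational lower bound is a lower bound on the marginal
log-likelihood: `L_dvae ≤ log p(x)`. -/
theorem dvae_lower_bound {A Z : Type*} [MeasurableSpace A] [MeasurableSpace Z]
    (μ : Measure A) (ν : Measure Z) [SigmaFinite μ] [SigmaFinite ν]
    -- corruption distribution density `p(x̃|x)`
    (pc : A → ℝ) (hpcm : Measurable pc) (hpc0 : ∀ a, 0 ≤ pc a) (hpc1 : ∫ a, pc a ∂μ = 1)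
    -- inference network density `q_φ(z|x̃)`
    (q : Z → A → ℝ) (hqm : Measurable fun w : Z × A => q w.1 w.2) (hq0 : ∀ z a, 0 < q z a)
    (hq1 : ∀ a, ∫ z, q z a ∂ν = 1)
    -- joint density `p(x, ·)` and marginal likelihood `p(x)`
    (pj : Z → ℝ) (hpjm : Measurable pj) (hpj0 : ∀ z, 0 < pj z)
    (px : ℝ) (hpx : px = ∫ z, pj z ∂ν) (hpxpos : 0 < px)
    -- the denoising variational lower bound
    (Ldvae : ℝ)
    (hLdvae : Ldvae = ∫ a, ∫ z, pc a * q z a * Real.log (pj z / q z a) ∂ν ∂μ)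
    (hint : Integrable
      (fun w : A × Z => pc w.1 * q w.2 w.1 * Real.log (pj w.2 / q w.2 w.1)) (μ.prod ν)) :
    Ldvae ≤ Real.log px := by
  have hpj : Integrable pj ν := .of_integral_ne_zero (by rw [← hpx]; exact hpxpos.ne')
  have hpc : Integrable pc μ := .of_integral_ne_zero (by rw [hpc1]; exact one_ne_zero)
  have hq : ∀ a, Integrable (fun z => q z a) ν := fun a =>
    .of_integral_ne_zero (by rw [hq1]; exact one_ne_zero)
  have inner_le : ∀ᵐ a ∂μ,
      ∫ z, pc a * q z a * Real.log (pj z / q z a) ∂ν ≤ pc a * Real.log px := by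
    filter_upwards [hint.prod_right_ae] with a ha
    have hd : Integrable (fun z => pj z / px - q z a) ν := (hpj.div_const px).sub (hq a)
    have hl : Integrable (fun z => q z a * Real.log px) ν := (hq a).mul_const _
    calc ∫ z, pc a * q z a * Real.log (pj z / q z a) ∂ν
        ≤ ∫ z, pc a * (pj z / px - q z a + q z a * Real.log px) ∂ν := by
          refine integral_mono ha ((hd.add hl).const_mul _) fun z => ?_
          simp only [mul_assoc]
          exact mul_le_mul_of_nonneg_left (mul_log_div_le (hq0 z a) (hpj0 z) hpxpos) (hpc0 a)
      _ = pc a * Real.log px := by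
          rw [integral_const_mul, integral_add hd hl,
            integral_sub (hpj.div_const px) (hq a), integral_div, integral_mul_const, hq1,
            ← hpx, div_self hpxpos.ne']
          ring
  calc Ldvae ≤ ∫ a, pc a * Real.log px ∂μ := by
        rw [hLdvae]
        exact integral_mono_ae hint.integral_prod_left (hpc.mul_const _) inner_le
    _ = Real.log px := by rw [integral_mul_const, hpc1, one_mul]
end

section
/- Under the denoising variational autoencoder setup, the marginal log-likelihood decomposes as log p(x) = L_dvae + ∫ p(x̃|x) · KL( q_φ(·|x̃) ‖ p(·|x) ) dμ(x̃); that is, the gap between log p(x) and the denoising variational lower bound equals the expectation, over the corruption distribution, of the KL divergence from the inference density given the corrupted input to the true posterior. -/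
open MeasureTheory

/-- Proposition 2: the marginal log-likelihood decomposes as
`log p(x) = L_dvae + ∫ p(x̃|x) KL(q_φ(·|x̃) ‖ p(·|x)) dμ(x̃)`. -/
theorem dvae_gap_eq_expected_KL {A Z : Type*} [MeasurableSpace A] [MeasurableSpace Z]
    (μ : Measure A) (ν : Measure Z) [SigmaFinite μ] [SigmaFinite ν]
    -- corruption distribution density `p(x̃|x)`
    (pc : A → ℝ) (hpcm : Measurable pc) (hpc0 : ∀ a, 0 ≤ pc a) (hpc1 : ∫ a, pc a ∂μ = 1)
    -- inference network density `q_φ(z|x̃)`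
    (q : Z → A → ℝ) (hqm : Measurable fun w : Z × A => q w.1 w.2) (hq0 : ∀ z a, 0 < q z a)
    (hq1 : ∀ a, ∫ z, q z a ∂ν = 1)
    -- joint density `p(x, ·)` and marginal likelihood `p(x)`
    (pj : Z → ℝ) (hpjm : Measurable pj) (hpj0 : ∀ z, 0 < pj z)
    (px : ℝ) (hpx : px = ∫ z, pj z ∂ν) (hpxpos : 0 < px)
    -- the denoising variational lower bound
    (Ldvae : ℝ)
    (hLdvae : Ldvae = ∫ a, ∫ z, pc a * q z a * Real.log (pj z / q z a) ∂ν ∂μ)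
    -- integrability (all integrals appearing are well defined and finite)
    (hint1 : Integrable
      (fun w : A × Z => pc w.1 * q w.2 w.1 * Real.log (pj w.2 / q w.2 w.1)) (μ.prod ν))
    (hint2 : Integrable
      (fun w : A × Z => pc w.1 * q w.2 w.1 * Real.log (q w.2 w.1 / (pj w.2 / px)))
      (μ.prod ν))
    (hint3 : Integrable (fun w : A × Z => pc w.1 * q w.2 w.1) (μ.prod ν)) :
    Real.log px
      = Ldvae + ∫ a, pc a * ∫ z, q z a * Real.log (q z a / (pj z / px)) ∂ν ∂μ := by
  have hpoint (a : A) (z : Z) :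
      pc a * q z a * Real.log (pj z / q z a)
        + pc a * q z a * Real.log (q z a / (pj z / px)) = pc a * q z a * Real.log px := by
    have hq := (hq0 z a).ne'
    have hpj := (hpj0 z).ne'
    rw [← mul_add, Real.log_div hpj hq, Real.log_div hq (div_ne_zero hpj hpxpos.ne'),
      Real.log_div hpj hpxpos.ne']
    ring
  have hmass : ∫ w : A × Z, pc w.1 * q w.2 w.1 ∂(μ.prod ν) = 1 := by
    rw [integral_prod _ hint3]
    simp only [integral_const_mul, hq1, mul_one, hpc1]
  have hKL : ∫ a, pc a * ∫ z, q z a * Real.log (q z a / (pj z / px)) ∂ν ∂μ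
      = ∫ w : A × Z, pc w.1 * q w.2 w.1 * Real.log (q w.2 w.1 / (pj w.2 / px)) ∂(μ.prod ν) := by
    rw [integral_prod _ hint2]
    simp only [mul_assoc, integral_const_mul]
  rw [hLdvae, hKL, ← integral_prod _ hint1, ← integral_add hint1 hint2]
  simp only [hpoint, integral_mul_const, hmass, one_mul]
end

section
/- Under the denoising variational autoencoder setup, the following identity holds: log p(x) − L_dvae = KL( q̃(·|x) ‖ p(·|x) ) + ∫∫ p(x̃|x) q_φ(z|x̃) log( q_φ(z|x̃)/q̃(z|x) ) dν(z) dμ(x̃). -/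
open MeasureTheory

/-- The identity
`log p(x) − L_dvae = KL(q̃(·|x) ‖ p(·|x)) + ∫∫ p(x̃|x) q_φ(z|x̃) log(q_φ(z|x̃)/q̃(z|x))`. -/
theorem dvae_gap_decomposition {A Z : Type*} [MeasurableSpace A] [MeasurableSpace Z]
    (μ : Measure A) (ν : Measure Z) [SigmaFinite μ] [SigmaFinite ν]
    -- corruption distribution density `p(x̃|x)`
    (pc : A → ℝ) (hpcm : Measurable pc) (hpc0 : ∀ a, 0 ≤ pc a) (hpc1 : ∫ a, pc a ∂μ = 1)
    -- inference network density `q_φ(z|x̃)`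
    (q : Z → A → ℝ) (hqm : Measurable fun w : Z × A => q w.1 w.2) (hq0 : ∀ z a, 0 < q z a)
    (hq1 : ∀ a, ∫ z, q z a ∂ν = 1)
    -- the mixture density `q̃(z|x) = ∫ q_φ(z|x̃) p(x̃|x) dμ(x̃)`
    (qt : Z → ℝ) (hqt : ∀ z, qt z = ∫ a, q z a * pc a ∂μ)
    -- joint density `p(x, ·)` and marginal likelihood `p(x)`
    (pj : Z → ℝ) (hpjm : Measurable pj) (hpj0 : ∀ z, 0 < pj z)
    (px : ℝ) (hpx : px = ∫ z, pj z ∂ν) (hpxpos : 0 < px)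
    -- the denoising variational lower bound
    (Ldvae : ℝ)
    (hLdvae : Ldvae = ∫ a, ∫ z, pc a * q z a * Real.log (pj z / q z a) ∂ν ∂μ)
    -- integrability (all integrals appearing are well defined and finite)
    (hint1 : Integrable
      (fun w : A × Z => pc w.1 * q w.2 w.1 * Real.log (pj w.2 / q w.2 w.1)) (μ.prod ν))
    (hint2 : Integrable
      (fun w : A × Z => pc w.1 * q w.2 w.1 * Real.log (q w.2 w.1 / qt w.2)) (μ.prod ν))
    (hint3 : Integrable (fun z => qt z * Real.log (qt z / (pj z / px))) ν)
    (hint4 : Integrable (fun w : A × Z => pc w.1 * q w.2 w.1) (μ.prod ν)) :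
    Real.log px - Ldvae
      = (∫ z, qt z * Real.log (qt z / (pj z / px)) ∂ν)
        + ∫ a, ∫ z, pc a * q z a * Real.log (q z a / qt z) ∂ν ∂μ := by
  have hpci : Integrable pc μ := by
    by_contra h
    simp [integral_undef h] at hpc1
  have hsupp : 0 < μ (Function.support pc) := by
    rw [← integral_pos_iff_support_of_nonneg hpc0 hpci, hpc1]
    exact one_pos
  have hqtpos : ∀ᵐ z ∂ν, 0 < qt z := by
    filter_upwards [hint4.prod_left_ae] with z hz
    have hz' : Integrable (fun a => q z a * pc a) μ := by simpa only [mul_comm] using hz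
    rw [hqt z, integral_pos_iff_support_of_nonneg
      (fun a => mul_nonneg (hq0 z a).le (hpc0 a)) hz']
    convert hsupp using 2
    ext a
    simp [(hq0 z a).ne']
  have hsplit : (fun w : A × Z =>
        pc w.1 * q w.2 w.1 * Real.log (qt w.2 / (pj w.2 / px))) =ᵐ[μ.prod ν]
      fun w => pc w.1 * q w.2 w.1 * Real.log px
        - pc w.1 * q w.2 w.1 * Real.log (pj w.2 / q w.2 w.1)
        - pc w.1 * q w.2 w.1 * Real.log (q w.2 w.1 / qt w.2) := by
    filter_upwards [Measure.quasiMeasurePreserving_snd.ae hqtpos] with w hw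
    have hj := (hpj0 w.2).ne'
    have hq := (hq0 w.2 w.1).ne'
    rw [Real.log_div hw.ne' (div_ne_zero hj hpxpos.ne'), Real.log_div hj hpxpos.ne',
      Real.log_div hj hq, Real.log_div hq hw.ne']
    ring
  have hconst := hint4.mul_const (Real.log px)
  have hint : Integrable (fun w : A × Z =>
      pc w.1 * q w.2 w.1 * Real.log (qt w.2 / (pj w.2 / px))) (μ.prod ν) :=
    ((hconst.sub hint1).sub hint2).congr hsplit.symm
  have hmass : ∫ w : A × Z, pc w.1 * q w.2 w.1 ∂(μ.prod ν) = 1 := by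
    rw [integral_prod _ hint4]
    simp only [integral_const_mul, hq1, mul_one, hpc1]
  have hKL : ∫ w : A × Z, pc w.1 * q w.2 w.1 * Real.log (qt w.2 / (pj w.2 / px)) ∂(μ.prod ν)
      = ∫ z, qt z * Real.log (qt z / (pj z / px)) ∂ν := by
    rw [integral_prod_symm _ hint]
    refine integral_congr_ae (.of_forall fun z => ?_)
    simp only [integral_mul_const]
    congr 1
    simp only [hqt z, mul_comm]
  have htotal := integral_congr_ae hsplit
  rw [integral_sub (by exact hconst.sub hint1) hint2, integral_sub hconst hint1, integral_mul_const,
    hmass, hKL, integral_prod _ hint1, integral_prod _ hint2] at htotal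
  rw [hLdvae]
  linarith
end

section
/- Under the denoising variational autoencoder setup, for any integer M ≥ 1, let (x̃_1, z_1), …, (x̃_M, z_M) be i.i.d. pairs where x̃_m is drawn from the corruption density p(·|x) and, given x̃_m, z_m is drawn from the inference density q_φ(·|x̃_m). Then the M-sample importance-weighted denoising objective is a lower bound on the marginal log-likelihood: E[ log( (1/M) ∑_{m=1}^{M} p(x, z_m) / q_φ(z_m|x̃_m) ) ] ≤ log p(x). -/
open MeasureTheory

/-- Jensen's inequality for the logarithm of the average of `M` i.i.d. copies of a positive
random variable. -/
lemma integral_log_average_pi_le {Ω : Type*} [MeasurableSpace Ω] (P : Measure Ω)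
    [IsProbabilityMeasure P] {w : Ω → ℝ} (hw0 : ∀ x, 0 < w x) (hw : Integrable w P)
    {M : ℕ} (hM : 1 ≤ M)
    (hint : Integrable (fun ω : Fin M → Ω => Real.log ((1 / (M : ℝ)) * ∑ m, w (ω m)))
      (Measure.pi fun _ => P)) :
    ∫ ω : Fin M → Ω, Real.log ((1 / (M : ℝ)) * ∑ m, w (ω m)) ∂(Measure.pi fun _ => P)
      ≤ Real.log (∫ x, w x ∂P) := by
  have hM0 : (0 : ℝ) < M := by exact_mod_cast hM
  have hc : 0 < ∫ x, w x ∂P := by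
    rw [integral_pos_iff_support_of_nonneg (fun x => (hw0 x).le) hw]
    have : Function.support w = Set.univ := Set.eq_univ_of_forall fun x => (hw0 x).ne'
    simp [this]
  set c := ∫ x, w x ∂P
  have hcoord (m : Fin M) :
      Integrable (fun ω : Fin M → Ω => w (ω m)) (Measure.pi fun _ => P) :=
    integrable_comp_eval (μ := fun _ : Fin M => P) hw
  have havg : Integrable (fun ω : Fin M → Ω => (1 / (M : ℝ)) * ∑ m, w (ω m))
      (Measure.pi fun _ => P) :=
    (integrable_finsetSum _ fun m _ => hcoord m).const_mul _
  have hmean : ∫ ω : Fin M → Ω, (1 / (M : ℝ)) * ∑ m, w (ω m) ∂(Measure.pi fun _ => P) = c := by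
    rw [integral_const_mul, integral_finsetSum _ fun m _ => hcoord m]
    have (m : Fin M) : ∫ ω : Fin M → Ω, w (ω m) ∂(Measure.pi fun _ => P) = c :=
      integral_comp_eval (μ := fun _ : Fin M => P) hw.aestronglyMeasurable
    simp only [this, Finset.sum_const, Finset.card_univ, Fintype.card_fin, nsmul_eq_mul]
    field_simp
  have hlin : Integrable (fun ω : Fin M → Ω =>
      ((1 / (M : ℝ)) * ∑ m, w (ω m)) / c + (Real.log c - 1)) (Measure.pi fun _ => P) :=
    (havg.div_const c).add (integrable_const _)
  calc
    _ ≤ ∫ ω : Fin M → Ω, (((1 / (M : ℝ)) * ∑ m, w (ω m)) / c + (Real.log c - 1))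
          ∂(Measure.pi fun _ => P) := by
      refine integral_mono hint hlin fun ω => ?_
      have hpos : 0 < (1 / (M : ℝ)) * ∑ m, w (ω m) :=
        mul_pos (by positivity)
          (Finset.sum_pos (fun m _ => hw0 (ω m)) ⟨⟨0, hM⟩, Finset.mem_univ _⟩)
      have h := Real.log_le_sub_one_of_pos (div_pos hpos hc)
      rw [Real.log_div hpos.ne' hc.ne'] at h
      dsimp only
      linarith
    _ = Real.log c := by
      rw [integral_add (havg.div_const c) (integrable_const _), integral_div, hmean,
        div_self hc.ne']
      simp

/-- The Lebesgue and Bochner integrals agree for a nonnegative function with nonzero Bochner integral. -/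
lemma lintegral_ofReal_eq_of_integral_ne_zero {α : Type*} [MeasurableSpace α] {μ : Measure α}
    {f : α → ℝ} (hf0 : ∀ x, 0 ≤ f x) (hf : ∫ x, f x ∂μ ≠ 0) :
    ∫⁻ x, ENNReal.ofReal (f x) ∂μ = ENNReal.ofReal (∫ x, f x ∂μ) :=
  (ofReal_integral_eq_lintegral_ofReal (Integrable.of_integral_ne_zero hf)
    (Filter.Eventually.of_forall hf0)).symm

/-- The `M`-sample importance-weighted denoising objective (DIWAE) is a lower bound on
the marginal log-likelihood. The `M` pairs `(x̃_m, z_m)` are i.i.d. with joint density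
`p(x̃|x) q_φ(z|x̃)` with respect to `μ ⊗ ν`. -/
theorem diwae_lower_bound {A Z : Type*} [MeasurableSpace A] [MeasurableSpace Z]
    (μ : Measure A) (ν : Measure Z) [SigmaFinite μ] [SigmaFinite ν]
    -- corruption distribution density `p(x̃|x)`
    (pc : A → ℝ) (hpcm : Measurable pc) (hpc0 : ∀ a, 0 ≤ pc a) (hpc1 : ∫ a, pc a ∂μ = 1)
    -- inference network density `q_φ(z|x̃)`
    (q : Z → A → ℝ) (hqm : Measurable fun w : Z × A => q w.1 w.2) (hq0 : ∀ z a, 0 < q z a)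
    (hq1 : ∀ a, ∫ z, q z a ∂ν = 1)
    -- joint density `p(x, ·)` and marginal likelihood `p(x)`
    (pj : Z → ℝ) (hpjm : Measurable pj) (hpj0 : ∀ z, 0 < pj z)
    (px : ℝ) (hpx : px = ∫ z, pj z ∂ν) (hpxpos : 0 < px)
    -- number of samples
    (M : ℕ) (hM : 1 ≤ M)
    -- integrability (all integrals appearing are well defined and finite)
    (hint : Integrable
      (fun ω : Fin M → A × Z =>
        Real.log ((1 / (M : ℝ)) * ∑ m, pj (ω m).2 / q (ω m).2 (ω m).1))
      (Measure.pi fun _ : Fin M =>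
        (μ.prod ν).withDensity fun w => ENNReal.ofReal (pc w.1 * q w.2 w.1))) :
    ∫ ω : Fin M → A × Z,
        Real.log ((1 / (M : ℝ)) * ∑ m, pj (ω m).2 / q (ω m).2 (ω m).1)
      ∂(Measure.pi fun _ : Fin M =>
        (μ.prod ν).withDensity fun w => ENNReal.ofReal (pc w.1 * q w.2 w.1))
      ≤ Real.log px := by
  have hq : Measurable fun w : A × Z => q w.2 w.1 := hqm.comp measurable_swap
  have hdens : Measurable fun w : A × Z => ENNReal.ofReal (pc w.1 * q w.2 w.1) :=
    ((hpcm.comp measurable_fst).mul hq).ennreal_ofReal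
  have hpc : ∫⁻ a, ENNReal.ofReal (pc a) ∂μ = 1 := by
    rw [lintegral_ofReal_eq_of_integral_ne_zero hpc0 (by simp [hpc1]), hpc1, ENNReal.ofReal_one]
  have hqz (a : A) : ∫⁻ z, ENNReal.ofReal (q z a) ∂ν = 1 := by
    rw [lintegral_ofReal_eq_of_integral_ne_zero (fun z => (hq0 z a).le) (by simp [hq1]), hq1,
      ENNReal.ofReal_one]
  have hpj : ∫⁻ z, ENNReal.ofReal (pj z) ∂ν = ENNReal.ofReal px := by
    rw [hpx] at hpxpos ⊢
    exact lintegral_ofReal_eq_of_integral_ne_zero (fun z => (hpj0 z).le) hpxpos.ne'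
  set P := (μ.prod ν).withDensity fun w => ENNReal.ofReal (pc w.1 * q w.2 w.1) with hP
  have hprob : IsProbabilityMeasure P := by
    refine ⟨?_⟩
    rw [hP, withDensity_apply _ MeasurableSet.univ, Measure.restrict_univ,
      lintegral_prod _ hdens.aemeasurable]
    have (a : A) : ∫⁻ z, ENNReal.ofReal (pc a * q z a) ∂ν = ENNReal.ofReal (pc a) := by
      simp only [ENNReal.ofReal_mul (hpc0 a)]
      rw [lintegral_const_mul' _ _ ENNReal.ofReal_ne_top, hqz, mul_one]
    simp only [this, hpc]
  have hwm : Measurable fun w : A × Z => pj w.2 / q w.2 w.1 :=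
    (hpjm.comp measurable_snd).div hq
  have hw0 (w : A × Z) : 0 < pj w.2 / q w.2 w.1 := div_pos (hpj0 _) (hq0 _ _)
  have hlint : ∫⁻ w, ENNReal.ofReal (pj w.2 / q w.2 w.1) ∂P = ENNReal.ofReal px := by
    rw [hP, lintegral_withDensity_eq_lintegral_mul _ hdens hwm.ennreal_ofReal]
    have (w : A × Z) : ENNReal.ofReal (pc w.1 * q w.2 w.1) * ENNReal.ofReal (pj w.2 / q w.2 w.1)
        = ENNReal.ofReal (pc w.1) * ENNReal.ofReal (pj w.2) := by
      rw [← ENNReal.ofReal_mul (mul_nonneg (hpc0 _) (hq0 _ _).le),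
        ← ENNReal.ofReal_mul (hpc0 _), mul_assoc, mul_div_cancel₀ _ (hq0 _ _).ne']
    simp only [Pi.mul_apply, this]
    rw [lintegral_prod_mul hpcm.ennreal_ofReal.aemeasurable hpjm.ennreal_ofReal.aemeasurable,
      hpc, hpj, one_mul]
  have hw : Integrable (fun w : A × Z => pj w.2 / q w.2 w.1) P := by
    refine ⟨hwm.aestronglyMeasurable, ?_⟩
    rw [hasFiniteIntegral_iff_ofReal (Filter.Eventually.of_forall fun w => (hw0 w).le), hlint]
    exact ENNReal.ofReal_lt_top
  have hmean : ∫ w, pj w.2 / q w.2 w.1 ∂P = px := by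
    rw [integral_eq_lintegral_of_nonneg_ae (Filter.Eventually.of_forall fun w => (hw0 w).le)
      hwm.aestronglyMeasurable, hlint, ENNReal.toReal_ofReal hpxpos.le]
  rw [← hmean]
  exact integral_log_average_pi_le P hw0 hw hM hint
end
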